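/- arXiv:1909.09518 — 2 statements merged into one kernel-verified Lean document; each statement's English description precedes it below -/
import Mathlib

section
/- Let T ∈ ℂ^m ⊗ ℂ^m ⊗ ℂ^m be a binding tensor (i.e., both 1_A- and 1_B-generic). Then dim G_T ≤ m² − 1, and equality holds if and only if T is isomorphic to T_{utriv,m} = a₁⊗b₁⊗c₁ + Σ_{ρ=2}^m a₁⊗b_ρ⊗c_ρ + Σ_{ρ=2}^m a_ρ⊗b₁⊗c_ρ. -/
open scoped BigOperators

/-- Leibniz-rule action; its kernel is the annihilator `g̃_T` of `T`, and
`dim G_T = dim g̃_T − 2`. -/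
noncomputable def tensorActionL (a b c : ℕ) (T : Fin a → Fin b → Fin c → ℂ) :
    (Matrix (Fin a) (Fin a) ℂ × Matrix (Fin b) (Fin b) ℂ × Matrix (Fin c) (Fin c) ℂ) →ₗ[ℂ]
      (Fin a → Fin b → Fin c → ℂ) where
  toFun p := fun i j k =>
    (∑ i', p.1 i i' * T i' j k) + (∑ j', p.2.1 j j' * T i j' k) +
      (∑ k', p.2.2 k k' * T i j k')
  map_add' p q := by
    funext i j k
    simp only [Prod.fst_add, Prod.snd_add, Matrix.add_apply, add_mul,
      Finset.sum_add_distrib, Pi.add_apply]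
    ring
  map_smul' t p := by
    funext i j k
    simp only [Prod.smul_fst, Prod.smul_snd, Matrix.smul_apply, smul_eq_mul,
      RingHom.id_apply, Pi.smul_apply, Finset.mul_sum, mul_add, mul_assoc]


/-- Contraction `T_A(α)` as a matrix. -/
noncomputable def contractA (m : ℕ) (T : Fin m → Fin m → Fin m → ℂ) (α : Fin m → ℂ) :
    Matrix (Fin m) (Fin m) ℂ :=
  Matrix.of fun j k => ∑ i, α i * T i j k

/-- Contraction `T_B(β)` as a matrix. -/
noncomputable def contractB (m : ℕ) (T : Fin m → Fin m → Fin m → ℂ) (β : Fin m → ℂ) :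
    Matrix (Fin m) (Fin m) ℂ :=
  Matrix.of fun i k => ∑ j, β j * T i j k

/-- `T` is binding if it is both `1_A`- and `1_B`-generic. -/
def Binding (m : ℕ) (T : Fin m → Fin m → Fin m → ℂ) : Prop :=
  (∃ α : Fin m → ℂ, IsUnit (contractA m T α).det) ∧
  (∃ β : Fin m → ℂ, IsUnit (contractB m T β).det)

/-- The orbit of a tensor `T` under `GL_a × GL_b × GL_c`; two tensors are
isomorphic iff they lie in the same orbit. -/
def glOrbit (a b c : ℕ) (T : Fin a → Fin b → Fin c → ℂ) :
    Set (Fin a → Fin b → Fin c → ℂ) :=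
  {S | ∃ (g : Matrix (Fin a) (Fin a) ℂ) (h : Matrix (Fin b) (Fin b) ℂ)
        (l : Matrix (Fin c) (Fin c) ℂ), IsUnit g.det ∧ IsUnit h.det ∧ IsUnit l.det ∧
      S = fun i j k => ∑ i', ∑ j', ∑ k', g i i' * h j j' * l k k' * T i' j' k'}

/-- The tensor `T_{utriv,m} = a₁⊗b₁⊗c₁ + Σ_{ρ≥2} a₁⊗b_ρ⊗c_ρ + Σ_{ρ≥2} a_ρ⊗b₁⊗c_ρ`. -/
noncomputable def Tutriv (m : ℕ) (hm : 1 ≤ m) : Fin m → Fin m → Fin m → ℂ :=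
  fun i j k =>
    if (i = ⟨0, hm⟩ ∧ j = ⟨0, hm⟩ ∧ k = ⟨0, hm⟩) ∨
       (i = ⟨0, hm⟩ ∧ j ≠ ⟨0, hm⟩ ∧ k = j) ∨
       (j = ⟨0, hm⟩ ∧ i ≠ ⟨0, hm⟩ ∧ k = i) then 1 else 0

section BilinearAnnihilator

variable {K A B C A' B' C' A'' B'' C'' : Type*} [Field K]
  [AddCommGroup A] [Module K A] [AddCommGroup B] [Module K B] [AddCommGroup C] [Module K C]
  [AddCommGroup A'] [Module K A'] [AddCommGroup B'] [Module K B'] [AddCommGroup C'] [Module K C']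
  [AddCommGroup A''] [Module K A''] [AddCommGroup B''] [Module K B'']
  [AddCommGroup C''] [Module K C'']

/-- The triples `(X, Y, Z)` of endomorphisms with `Z (μ x y) = μ (X x) y + μ x (Y y)`. -/
def bilinAnnihilator (μ : A →ₗ[K] B →ₗ[K] C) :
    Submodule K (Module.End K A × Module.End K B × Module.End K C) where
  carrier := {p | ∀ x y, p.2.2 (μ x y) = μ (p.1 x) y + μ x (p.2.1 y)}
  zero_mem' := by simp
  add_mem' {p q} hp hq x y := by
    simp only [Prod.fst_add, Prod.snd_add, LinearMap.add_apply, map_add, hp x y, hq x y]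
    abel
  smul_mem' t p hp x y := by
    simp [hp x y]

theorem mem_bilinAnnihilator {μ : A →ₗ[K] B →ₗ[K] C}
    {p : Module.End K A × Module.End K B × Module.End K C} :
    p ∈ bilinAnnihilator μ ↔ ∀ x y, p.2.2 (μ x y) = μ (p.1 x) y + μ x (p.2.1 y) :=
  Iff.rfl

/-- Two bilinear maps are isotopic if they differ by linear changes of coordinates in both
sources and in the target. -/
def Isotopic (μ : A →ₗ[K] B →ₗ[K] C) (ν : A' →ₗ[K] B' →ₗ[K] C') : Prop :=
  ∃ (P : A ≃ₗ[K] A') (Q : B ≃ₗ[K] B') (R : C ≃ₗ[K] C'), ∀ x y, R (μ x y) = ν (P x) (Q y)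

theorem Isotopic.trans {μ : A →ₗ[K] B →ₗ[K] C} {ν : A' →ₗ[K] B' →ₗ[K] C'}
    {ξ : A'' →ₗ[K] B'' →ₗ[K] C''} (h : Isotopic μ ν) (h' : Isotopic ν ξ) : Isotopic μ ξ := by
  obtain ⟨P, Q, R, h⟩ := h
  obtain ⟨P', Q', R', h'⟩ := h'
  exact ⟨P.trans P', Q.trans Q', R.trans R', fun x y => by simp [h, h']⟩

theorem Isotopic.finrank_bilinAnnihilator_eq {μ : A →ₗ[K] B →ₗ[K] C}
    {ν : A' →ₗ[K] B' →ₗ[K] C'} (h : Isotopic μ ν) :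
    Module.finrank K (bilinAnnihilator μ) = Module.finrank K (bilinAnnihilator ν) := by
  obtain ⟨P, Q, R, h⟩ := h
  have hsymm : ∀ x y, R.symm (ν (P x) (Q y)) = μ x y := fun x y => by
    rw [LinearEquiv.symm_apply_eq, h]
  let E := P.conj.prodCongr (Q.conj.prodCongr R.conj)
  suffices hE : bilinAnnihilator μ = (bilinAnnihilator ν).comap E.toLinearMap by
    rw [hE]
    exact (LinearEquiv.ofSubmodule' E (bilinAnnihilator ν)).finrank_eq
  symm
  ext p
  rw [Submodule.mem_comap, mem_bilinAnnihilator, mem_bilinAnnihilator]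
  constructor
  · intro hp x y
    apply R.injective
    simpa [E, LinearEquiv.conj_apply, h, hsymm] using hp (P x) (Q y)
  · intro hp x y
    obtain ⟨x, rfl⟩ := P.surjective x
    obtain ⟨y, rfl⟩ := Q.surjective y
    simpa [E, LinearEquiv.conj_apply, h, hsymm] using congrArg R (hp x y)

/-- If some left and some right translation are invertible, the bilinear map is isotopic to a
multiplication with a two-sided unit. -/
theorem exists_isotopic_unital (μ : A →ₗ[K] B →ₗ[K] C) {α : A} {β : B}
    (hα : Function.Bijective (μ α)) (hβ : Function.Bijective (μ.flip β)) :
    ∃ (ν : C →ₗ[K] C →ₗ[K] C) (e : C), (∀ y, ν e y = y) ∧ (∀ x, ν x e = x) ∧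
      Isotopic μ ν := by
  let P := LinearEquiv.ofBijective _ hβ
  let Q := LinearEquiv.ofBijective _ hα
  have hP : P.symm (μ α β) = α := by rw [LinearEquiv.symm_apply_eq]; rfl
  have hQ : Q.symm (μ α β) = β := by rw [LinearEquiv.symm_apply_eq]; rfl
  refine ⟨μ.compl₁₂ P.symm.toLinearMap Q.symm.toLinearMap, μ α β, fun y => ?_, fun x => ?_,
    P, Q, LinearEquiv.refl K C, fun x y => by simp⟩
  · simpa [hP] using (show μ α (Q.symm y) = y from Q.apply_symm_apply y)
  · simpa [hQ] using (show μ (P.symm x) β = x from P.apply_symm_apply x)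

end BilinearAnnihilator

section Unital

variable {K V W : Type*} [Field K] [AddCommGroup V] [Module K V] [AddCommGroup W] [Module K W]

/-- `μ` is the multiplication of the unital algebra `K e ⊕ ker l` in which `ker l` has zero
multiplication. -/
def IsTrivialUnital (μ : V →ₗ[K] V →ₗ[K] V) (l : V →ₗ[K] K) (e : V) : Prop :=
  l e = 1 ∧ ∀ x y, μ x y = l x • y + l y • x - (l x * l y) • e

/-- The projection onto `ker l` along `e`. -/
def projKer (l : V →ₗ[K] K) (e : V) (he : l e = 1) : V →ₗ[K] LinearMap.ker l :=
  LinearMap.codRestrict _ (LinearMap.id - l.smulRight e) (by simp [he])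

@[simp]
theorem coe_projKer (l : V →ₗ[K] K) (e : V) (he : l e = 1) (x : V) :
    (projKer l e he x : V) = x - l x • e := rfl

theorem finrank_ker_add_one [FiniteDimensional K V] {l : V →ₗ[K] K} {e : V} (he : l e = 1) :
    Module.finrank K (LinearMap.ker l) + 1 = Module.finrank K V := by
  have hs : LinearMap.range l = ⊤ :=
    LinearMap.range_eq_top.2 fun t => ⟨t • e, by simp [he]⟩
  have h := l.finrank_range_add_finrank_ker
  rw [hs, finrank_top, Module.finrank_self] at h
  omega

theorem IsTrivialUnital.isotopic [FiniteDimensional K V] [FiniteDimensional K W]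
    {μ : V →ₗ[K] V →ₗ[K] V} {l : V →ₗ[K] K} {e : V}
    {ν : W →ₗ[K] W →ₗ[K] W} {l' : W →ₗ[K] K} {e' : W}
    (h : IsTrivialUnital μ l e) (h' : IsTrivialUnital ν l' e')
    (hd : Module.finrank K V = Module.finrank K W) : Isotopic μ ν := by
  obtain ⟨he, hμ⟩ := h
  obtain ⟨he', hν⟩ := h'
  have hk : Module.finrank K (LinearMap.ker l) = Module.finrank K (LinearMap.ker l') := by
    have := finrank_ker_add_one he
    have := finrank_ker_add_one he'
    omega
  let f := LinearEquiv.ofFinrankEq _ _ hk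
  let F : V →ₗ[K] W :=
    (LinearMap.ker l').subtype ∘ₗ f.toLinearMap ∘ₗ projKer l e he + l.smulRight e'
  have hF : ∀ x, F x = (f (projKer l e he x) : W) + l x • e' := fun x => rfl
  have hl : ∀ x, l' (F x) = l x := fun x => by
    rw [hF, map_add, LinearMap.mem_ker.1 (f (projKer l e he x)).2]
    simp [he']
  have hFe : F e = e' := by
    have : projKer l e he e = 0 := by ext; simp [he]
    simp [hF, this, he]
  have hinj : Function.Injective F := by
    rw [injective_iff_map_eq_zero]
    intro x hx
    have hx0 : l x = 0 := by rw [← hl, hx, map_zero]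
    rw [hF, hx0, zero_smul, add_zero, ZeroMemClass.coe_eq_zero, f.map_eq_zero_iff] at hx
    simpa [hx0] using congrArg Subtype.val hx
  let E := LinearEquiv.ofInjectiveOfFinrankEq F hinj hd
  have hE : ∀ x, E x = F x := fun x => rfl
  exact ⟨E, E, E, fun x y => by simp [hE, hμ, hν, hl, hFe]⟩

/-- The linear map sending `(X, Y, Z)` to `X e`, `Y e` and the compression of `Z` to `ker l`. -/
def annihilatorCoords (μ : V →ₗ[K] V →ₗ[K] V) (l : V →ₗ[K] K) (e : V) (he : l e = 1) :
    bilinAnnihilator μ →ₗ[K] V × V × Module.End K (LinearMap.ker l) where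
  toFun p := (p.1.1 e, p.1.2.1 e, projKer l e he ∘ₗ p.1.2.2 ∘ₗ (LinearMap.ker l).subtype)
  map_add' p q := by
    simp [LinearMap.add_comp, LinearMap.comp_add]
  map_smul' t p := by
    simp [LinearMap.smul_comp, LinearMap.comp_smul]

theorem finrank_annihilatorCoords_target [FiniteDimensional K V] {l : V →ₗ[K] K} {e : V}
    (he : l e = 1) :
    Module.finrank K (V × V × Module.End K (LinearMap.ker l)) = Module.finrank K V ^ 2 + 1 := by
  rw [Module.finrank_prod, Module.finrank_prod, Module.finrank_linearMap,
    ← finrank_ker_add_one he]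
  ring

/-- A triple annihilating a unital multiplication whose first two entries kill the unit consists
of three copies of a derivation. -/
theorem eq_of_mem_bilinAnnihilator_of_apply_unit {μ : V →ₗ[K] V →ₗ[K] V} {e : V}
    (hl : ∀ y, μ e y = y) (hr : ∀ x, μ x e = x) {X Y Z : Module.End K V}
    (h : (X, Y, Z) ∈ bilinAnnihilator μ) (hX : X e = 0) (hY : Y e = 0) : X = Z ∧ Y = Z := by
  rw [mem_bilinAnnihilator] at h
  constructor
  · ext x
    simpa [hY, hr] using (h x e).symm
  · ext y
    simpa [hX, hl] using (h e y).symm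

theorem annihilatorCoords_injective [NeZero (2 : K)] {μ : V →ₗ[K] V →ₗ[K] V} {e : V}
    (hl : ∀ y, μ e y = y) (hr : ∀ x, μ x e = x) (l : V →ₗ[K] K) (he : l e = 1) :
    Function.Injective (annihilatorCoords μ l e he) := by
  rw [injective_iff_map_eq_zero]
  rintro ⟨⟨X, Y, Z⟩, h⟩ h0
  obtain ⟨hX, hY, hZ⟩ : X e = 0 ∧ Y e = 0 ∧
      projKer l e he ∘ₗ Z ∘ₗ (LinearMap.ker l).subtype = 0 := by
    simpa [annihilatorCoords] using h0
  obtain ⟨rfl, rfl⟩ := eq_of_mem_bilinAnnihilator_of_apply_unit hl hr h hX hY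
  rw [mem_bilinAnnihilator] at h
  dsimp only at h
  have hscalar : ∀ x, Y x = l (Y x) • e := fun x => by
    have hx := congrArg Subtype.val (LinearMap.congr_fun hZ (projKer l e he x))
    simpa [hX, sub_eq_zero] using hx
  have hzero : Y = 0 := by
    ext x
    by_contra hx
    have hc : l (Y x) ≠ 0 := fun hc => hx (by rw [hscalar x, hc]; simp)
    have hsq := h x x
    rw [hscalar (μ x x), hscalar x] at hsq
    simp only [map_smul, LinearMap.smul_apply, hl, hr, ← two_smul K] at hsq
    have hxe : x = (l (Y x))⁻¹ • (2 : K)⁻¹ • l (Y (μ x x)) • e := by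
      rw [hsq, inv_smul_smul₀ (NeZero.ne (2 : K)), inv_smul_smul₀ hc]
    apply hx
    rw [hxe]
    simp [hX]
  simp [hzero]

theorem IsTrivialUnital.annihilatorCoords_surjective {μ : V →ₗ[K] V →ₗ[K] V} {l : V →ₗ[K] K}
    {e : V} (h : IsTrivialUnital μ l e) :
    Function.Surjective (annihilatorCoords μ l e h.1) := by
  obtain ⟨he, hμ⟩ := h
  rintro ⟨a, b, D⟩
  let w : Module.End K V := (LinearMap.ker l).subtype ∘ₗ D ∘ₗ projKer l e he
  have hw : ∀ x, w x = (D (projKer l e he x) : V) := fun x => rfl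
  have hlw : ∀ x, l (w x) = 0 := fun x => (D (projKer l e he x)).2
  have hwe : w e = 0 := by
    have : projKer l e he e = 0 := by ext; simp [he]
    simp [hw, this]
  let Z : Module.End K V := w + l.smulRight (a + b)
  have hZ : ∀ x, Z x = w x + l x • (a + b) := fun x => rfl
  refine ⟨⟨(Z - μ.flip b, Z - μ a, Z), fun x y => ?_⟩, ?_⟩
  · simp only [LinearMap.sub_apply, LinearMap.flip_apply, LinearMap.add_apply, LinearMap.smul_apply,
      hZ, hμ, map_add, map_sub, map_smul, hlw, hwe, he, smul_eq_mul]
    module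
  · refine Prod.ext ?_ (Prod.ext ?_ ?_)
    · simp only [annihilatorCoords, LinearMap.coe_mk, AddHom.coe_mk, LinearMap.sub_apply,
        LinearMap.flip_apply, hZ, hwe, hμ, he]
      module
    · simp only [annihilatorCoords, LinearMap.coe_mk, AddHom.coe_mk, LinearMap.sub_apply,
        hZ, hwe, hμ, he]
      module
    · refine LinearMap.ext fun x => Subtype.ext ?_
      have hx : l x = 0 := x.2
      have hp : projKer l e he x = x := by ext; simp [hx]
      simp [annihilatorCoords, hZ, hw, hx, hp]

theorem exists_isTrivialUnital_of_surjective [NeZero (2 : K)] {μ : V →ₗ[K] V →ₗ[K] V} {e : V}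
    (hl : ∀ y, μ e y = y) (hr : ∀ x, μ x e = x) {l : V →ₗ[K] K} {he : l e = 1}
    (hs : Function.Surjective (annihilatorCoords μ l e he)) :
    ∃ l' : V →ₗ[K] K, IsTrivialUnital μ l' e := by
  obtain ⟨⟨⟨X, Y, Z⟩, h⟩, hc⟩ := hs (0, 0, LinearMap.id)
  obtain ⟨hX, hY, hZ⟩ : X e = 0 ∧ Y e = 0 ∧
      projKer l e he ∘ₗ Z ∘ₗ (LinearMap.ker l).subtype = LinearMap.id := by
    simpa [annihilatorCoords] using hc
  obtain ⟨rfl, rfl⟩ := eq_of_mem_bilinAnnihilator_of_apply_unit hl hr h hX hY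
  rw [mem_bilinAnnihilator] at h
  dsimp only at h
  have hdec : ∀ x, Y x = x - (l x - l (Y x)) • e := fun x => by
    have hx := congrArg Subtype.val (LinearMap.congr_fun hZ (projKer l e he x))
    simp only [LinearMap.comp_apply, Submodule.subtype_apply, coe_projKer, map_sub, map_smul, hX,
      smul_zero, sub_zero, LinearMap.id_apply] at hx
    rw [sub_eq_iff_eq_add] at hx
    rw [hx]
    simp only [map_add, map_sub, map_smul, he, smul_eq_mul]
    module
  have hidem : ∀ x, Y (Y x) = Y x := fun x => by
    conv_lhs => rw [hdec x]
    simp [hX]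
  have hmul : ∀ x y, μ (Y x) (Y y) = 0 := fun x y => by
    have h1 := h (Y x) (Y y)
    rw [hidem, hidem, ← two_smul K] at h1
    have h2 := congrArg Y h1
    rw [hidem, map_smul, h1, smul_smul, ← sub_eq_zero, ← sub_smul] at h2
    refine (smul_eq_zero.1 h2).resolve_left ?_
    have h3 : (2 - 2 * 2 : K) = -2 := by ring
    rw [h3]
    exact neg_ne_zero.2 (NeZero.ne 2)
  refine ⟨l - l ∘ₗ Y, by simp [hX, he], fun x y => ?_⟩
  have hxy := hmul x y
  rw [hdec x, hdec y] at hxy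
  simp only [map_sub, map_smul, LinearMap.sub_apply, LinearMap.smul_apply, hl, hr] at hxy
  rw [← sub_eq_zero, ← hxy]
  simp only [LinearMap.sub_apply, LinearMap.comp_apply]
  module

theorem finrank_bilinAnnihilator_le [NeZero (2 : K)] [FiniteDimensional K V] [Nontrivial V]
    {μ : V →ₗ[K] V →ₗ[K] V} {e : V} (hl : ∀ y, μ e y = y) (hr : ∀ x, μ x e = x) :
    Module.finrank K (bilinAnnihilator μ) ≤ Module.finrank K V ^ 2 + 1 ∧
    (Module.finrank K (bilinAnnihilator μ) = Module.finrank K V ^ 2 + 1 →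
      ∃ l : V →ₗ[K] K, IsTrivialUnital μ l e) := by
  have he0 : e ≠ 0 := by
    rintro rfl
    obtain ⟨x, hx⟩ := exists_ne (0 : V)
    exact hx (by simpa using (hl x).symm)
  obtain ⟨l, he⟩ := Module.Projective.exists_dual_eq_one K he0
  have hinj := annihilatorCoords_injective hl hr l he
  rw [← finrank_annihilatorCoords_target he]
  exact ⟨LinearMap.finrank_le_finrank_of_injective hinj, fun heq =>
    exists_isTrivialUnital_of_surjective hl hr
      ((LinearMap.injective_iff_surjective_of_finrank_eq_finrank heq).1 hinj)⟩

theorem IsTrivialUnital.finrank_bilinAnnihilator [NeZero (2 : K)] [FiniteDimensional K V]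
    {μ : V →ₗ[K] V →ₗ[K] V} {l : V →ₗ[K] K} {e : V} (h : IsTrivialUnital μ l e) :
    Module.finrank K (bilinAnnihilator μ) = Module.finrank K V ^ 2 + 1 := by
  have hl : ∀ y, μ e y = y := fun y => by rw [h.2, h.1]; module
  have hr : ∀ x, μ x e = x := fun x => by rw [h.2, h.1]; module
  rw [← finrank_annihilatorCoords_target h.1]
  exact (LinearEquiv.ofBijective _
    ⟨annihilatorCoords_injective hl hr l h.1, h.annihilatorCoords_surjective⟩).finrank_eq

end Unital

section Tensor

open Matrix

variable {m : ℕ}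

/-- The bilinear map `A* × B* → C` attached to a tensor in `A ⊗ B ⊗ C`. -/
noncomputable def tensorBilin (T : Fin m → Fin m → Fin m → ℂ) :
    (Fin m → ℂ) →ₗ[ℂ] (Fin m → ℂ) →ₗ[ℂ] (Fin m → ℂ) :=
  LinearMap.mk₂ ℂ (fun α β k => ∑ i, ∑ j, α i * β j * T i j k)
    (fun α α' β => by
      ext k; simp only [Pi.add_apply, add_mul, Finset.sum_add_distrib])
    (fun t α β => by
      ext k; simp only [Pi.smul_apply, smul_eq_mul, Finset.mul_sum, mul_assoc])
    (fun α β β' => by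
      ext k; simp only [Pi.add_apply, mul_add, add_mul, Finset.sum_add_distrib])
    (fun t α β => by
      ext k
      simp only [Pi.smul_apply, smul_eq_mul, Finset.mul_sum]
      exact Finset.sum_congr rfl fun i _ => Finset.sum_congr rfl fun j _ => by ring)

theorem tensorBilin_apply (T : Fin m → Fin m → Fin m → ℂ) (α β : Fin m → ℂ) (k : Fin m) :
    tensorBilin T α β k = ∑ i, ∑ j, α i * β j * T i j k := rfl

theorem tensorBilin_single (T : Fin m → Fin m → Fin m → ℂ) (i j k : Fin m) :
    tensorBilin T (Pi.single i 1) (Pi.single j 1) k = T i j k := by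
  simp [tensorBilin_apply, Pi.single_apply]

theorem tensorBilin_eq_vecMul_contractA (T : Fin m → Fin m → Fin m → ℂ) (α β : Fin m → ℂ) :
    tensorBilin T α β = β ᵥ* contractA m T α := by
  ext k
  simp only [tensorBilin_apply, Matrix.vecMul, dotProduct, contractA, Matrix.of_apply,
    Finset.mul_sum]
  rw [Finset.sum_comm]
  exact Finset.sum_congr rfl fun i _ => Finset.sum_congr rfl fun j _ => by ring

theorem tensorBilin_eq_vecMul_contractB (T : Fin m → Fin m → Fin m → ℂ) (α β : Fin m → ℂ) :
    tensorBilin T α β = α ᵥ* contractB m T β := by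
  ext k
  simp only [tensorBilin_apply, Matrix.vecMul, dotProduct, contractB, Matrix.of_apply,
    Finset.mul_sum, mul_assoc]

theorem bijective_vecMul {M : Matrix (Fin m) (Fin m) ℂ} (hM : IsUnit M.det) :
    Function.Bijective fun v : Fin m → ℂ => v ᵥ* M := by
  have hM' := (Matrix.isUnit_iff_isUnit_det M).2 hM
  exact ⟨Matrix.vecMul_injective_iff_isUnit.2 hM', Matrix.vecMul_surjective_iff_isUnit.2 hM'⟩

theorem Binding.exists_isotopic_unital {T : Fin m → Fin m → Fin m → ℂ} (h : Binding m T) :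
    ∃ (ν : (Fin m → ℂ) →ₗ[ℂ] (Fin m → ℂ) →ₗ[ℂ] (Fin m → ℂ)) (e : Fin m → ℂ),
      (∀ y, ν e y = y) ∧ (∀ x, ν x e = x) ∧ Isotopic (tensorBilin T) ν := by
  obtain ⟨⟨α, hα⟩, β, hβ⟩ := h
  refine _root_.exists_isotopic_unital (tensorBilin T) (α := (α : Fin m → ℂ))
    (β := (β : Fin m → ℂ)) ?_ ?_
  · convert bijective_vecMul hα using 1
    exact funext fun y => tensorBilin_eq_vecMul_contractA T α y
  · convert bijective_vecMul hβ using 1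
    exact funext fun x => tensorBilin_eq_vecMul_contractB T x β

theorem tensorBilin_tensorActionL (T : Fin m → Fin m → Fin m → ℂ)
    (X Y Z : Matrix (Fin m) (Fin m) ℂ) (α β : Fin m → ℂ) :
    tensorBilin (tensorActionL m m m T (X, Y, Z)) α β =
      tensorBilin T (Xᵀ *ᵥ α) β + tensorBilin T α (Yᵀ *ᵥ β) + Z *ᵥ tensorBilin T α β := by
  ext k
  have hX : tensorBilin T (Xᵀ *ᵥ α) β k =
      ∑ i, ∑ j, α i * β j * ∑ i', X i i' * T i' j k := by
    simp only [tensorBilin_apply, Matrix.mulVec, dotProduct, Matrix.transpose_apply,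
      Finset.mul_sum, Finset.sum_mul]
    rw [Finset.sum_comm_cycle]
    refine Finset.sum_congr rfl fun i _ => ?_
    rw [Finset.sum_comm]
    exact Finset.sum_congr rfl fun j _ => Finset.sum_congr rfl fun i' _ => by ring
  have hY : tensorBilin T α (Yᵀ *ᵥ β) k =
      ∑ i, ∑ j, α i * β j * ∑ j', Y j j' * T i j' k := by
    simp only [tensorBilin_apply, Matrix.mulVec, dotProduct, Matrix.transpose_apply,
      Finset.mul_sum, Finset.sum_mul]
    refine Finset.sum_congr rfl fun i _ => ?_
    rw [Finset.sum_comm]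
    exact Finset.sum_congr rfl fun j _ => Finset.sum_congr rfl fun j' _ => by ring
  have hZ : (Z *ᵥ tensorBilin T α β) k =
      ∑ i, ∑ j, α i * β j * ∑ k', Z k k' * T i j k' := by
    simp only [tensorBilin_apply, Matrix.mulVec, dotProduct, Finset.mul_sum]
    rw [Finset.sum_comm]
    refine Finset.sum_congr rfl fun i _ => ?_
    rw [Finset.sum_comm]
    exact Finset.sum_congr rfl fun j _ => Finset.sum_congr rfl fun j' _ => by ring
  rw [Pi.add_apply, Pi.add_apply, hX, hY, hZ, tensorBilin_apply]
  simp only [tensorActionL, LinearMap.coe_mk, AddHom.coe_mk, mul_add, Finset.sum_add_distrib]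

theorem finrank_ker_tensorActionL (T : Fin m → Fin m → Fin m → ℂ) :
    Module.finrank ℂ (LinearMap.ker (tensorActionL m m m T)) =
      Module.finrank ℂ (bilinAnnihilator (tensorBilin T)) := by
  let τ : Matrix (Fin m) (Fin m) ℂ ≃ₗ[ℂ] Module.End ℂ (Fin m → ℂ) :=
    (Matrix.transposeLinearEquiv (Fin m) (Fin m) ℂ ℂ).trans Matrix.toLin'
  let σ : Matrix (Fin m) (Fin m) ℂ ≃ₗ[ℂ] Module.End ℂ (Fin m → ℂ) :=
    (LinearEquiv.neg ℂ).trans Matrix.toLin'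
  let E := τ.prodCongr (τ.prodCongr σ)
  suffices hE : LinearMap.ker (tensorActionL m m m T) =
      (bilinAnnihilator (tensorBilin T)).comap E.toLinearMap by
    rw [hE]
    exact (LinearEquiv.ofSubmodule' E (bilinAnnihilator (tensorBilin T))).finrank_eq
  ext ⟨X, Y, Z⟩
  have hmem : E (X, Y, Z) ∈ bilinAnnihilator (tensorBilin T) ↔
      ∀ α β, tensorBilin (tensorActionL m m m T (X, Y, Z)) α β = 0 := by
    simp only [mem_bilinAnnihilator, tensorBilin_tensorActionL]
    refine forall_congr' fun α => forall_congr' fun β => ?_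
    simp [E, τ, σ, neg_eq_iff_add_eq_zero, add_comm]
  rw [Submodule.mem_comap, LinearMap.mem_ker]
  refine Iff.trans ⟨fun h α β => ?_, fun h => ?_⟩ hmem.symm
  · ext k
    simp [h, tensorBilin_apply]
  · funext i j k
    rw [← tensorBilin_single (tensorActionL m m m T (X, Y, Z)), h]
    rfl

theorem tensorBilin_transform (S : Fin m → Fin m → Fin m → ℂ)
    (g h l : Matrix (Fin m) (Fin m) ℂ) (α β : Fin m → ℂ) :
    tensorBilin (fun i j k => ∑ i', ∑ j', ∑ k', g i i' * h j j' * l k k' * S i' j' k') α β =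
      l *ᵥ tensorBilin S (α ᵥ* g) (β ᵥ* h) := by
  suffices hlin : tensorBilin
      (fun i j k => ∑ i', ∑ j', ∑ k', g i i' * h j j' * l k k' * S i' j' k') =
      ((tensorBilin S).compl₁₂ g.vecMulLinear h.vecMulLinear).compr₂ l.mulVecLin by
    rw [hlin]
    rfl
  ext i j k
  simp only [LinearMap.comp_apply, LinearMap.coe_single]
  rw [tensorBilin_single]
  simp only [LinearMap.compr₂_apply, LinearMap.compl₁₂_apply, Matrix.vecMulLinear_apply,
    Matrix.single_one_vecMul, Matrix.mulVecLin_apply, Matrix.mulVec, dotProduct,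
    tensorBilin_apply, Finset.mul_sum, Matrix.row]
  rw [Finset.sum_comm_cycle]
  exact Finset.sum_congr rfl fun k' _ => Finset.sum_congr rfl fun i' _ =>
    Finset.sum_congr rfl fun j' _ => by ring

theorem mem_glOrbit_iff_isotopic {T S : Fin m → Fin m → Fin m → ℂ} :
    T ∈ glOrbit m m m S ↔ Isotopic (tensorBilin T) (tensorBilin S) := by
  constructor
  · rintro ⟨g, h, l, hg, hh, hl, rfl⟩
    have hl' : Function.Bijective l.mulVecLin := by
      have hl' := (Matrix.isUnit_iff_isUnit_det l).2 hl
      exact ⟨Matrix.mulVec_injective_iff_isUnit.2 hl',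
        Matrix.mulVec_surjective_iff_isUnit.2 hl'⟩
    refine ⟨LinearEquiv.ofBijective g.vecMulLinear (bijective_vecMul hg),
      LinearEquiv.ofBijective h.vecMulLinear (bijective_vecMul hh),
      (LinearEquiv.ofBijective l.mulVecLin hl').symm, fun x y => ?_⟩
    rw [LinearEquiv.symm_apply_eq, tensorBilin_transform]
    rfl
  · rintro ⟨P, Q, R, h⟩
    have hdet : ∀ F : (Fin m → ℂ) ≃ₗ[ℂ] (Fin m → ℂ),
        IsUnit (LinearMap.toMatrix' F.toLinearMap).det := fun F => by
      rw [LinearMap.det_toMatrix']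
      exact F.isUnit_det'
    refine ⟨(LinearMap.toMatrix' P.toLinearMap)ᵀ, (LinearMap.toMatrix' Q.toLinearMap)ᵀ,
      LinearMap.toMatrix' R.symm.toLinearMap, ?_, ?_, hdet _, ?_⟩
    · rw [Matrix.det_transpose]
      exact hdet P
    · rw [Matrix.det_transpose]
      exact hdet Q
    · funext i j k
      have hS := congrFun (tensorBilin_transform S (LinearMap.toMatrix' P.toLinearMap)ᵀ
        (LinearMap.toMatrix' Q.toLinearMap)ᵀ (LinearMap.toMatrix' R.symm.toLinearMap)
        (Pi.single i 1) (Pi.single j 1)) k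
      rw [tensorBilin_single] at hS
      rw [hS, ← tensorBilin_single T, Matrix.vecMul_transpose, Matrix.vecMul_transpose,
        LinearMap.toMatrix'_mulVec, LinearMap.toMatrix'_mulVec, LinearMap.toMatrix'_mulVec]
      simp [← h]

theorem isTrivialUnital_Tutriv (hm : 1 ≤ m) :
    IsTrivialUnital (tensorBilin (Tutriv m hm)) (LinearMap.proj ⟨0, hm⟩)
      (Pi.single ⟨0, hm⟩ 1) := by
  refine ⟨by simp, fun x y => ?_⟩
  ext k
  have hT : ∀ i j, x i * y j * Tutriv m hm i j k =
      (if i = ⟨0, hm⟩ then if j = k then x i * y j else 0 else 0) +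
      (if j = ⟨0, hm⟩ then if i = k then x i * y j else 0 else 0) -
      (if i = ⟨0, hm⟩ then if j = ⟨0, hm⟩ then if k = ⟨0, hm⟩ then x i * y j else 0 else 0
        else 0) := by
    intro i j
    unfold Tutriv
    grind
  simp only [tensorBilin_apply, hT, Finset.sum_add_distrib, Finset.sum_sub_distrib]
  simp [Finset.sum_ite_irrel, Pi.single_apply, mul_comm]

end Tensor

/-- A binding tensor `T ∈ ℂ^m ⊗ ℂ^m ⊗ ℂ^m` satisfies `dim G_T ≤ m² − 1`
(i.e. `dim g̃_T ≤ m² + 1`), with equality iff `T` is isomorphic to `T_{utriv,m}`. -/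
theorem binding_max_symmetry (m : ℕ) (hm : 1 ≤ m)
    (T : Fin m → Fin m → Fin m → ℂ) (hbind : Binding m T) :
    Module.finrank ℂ (LinearMap.ker (tensorActionL m m m T)) ≤ m ^ 2 + 1 ∧
    (Module.finrank ℂ (LinearMap.ker (tensorActionL m m m T)) = m ^ 2 + 1 ↔
      T ∈ glOrbit m m m (Tutriv m hm)) := by
  have : Nonempty (Fin m) := ⟨⟨0, hm⟩⟩
  have hU := isTrivialUnital_Tutriv hm
  obtain ⟨ν, e, hl, hr, hiso⟩ := hbind.exists_isotopic_unital
  obtain ⟨hle, heq⟩ := finrank_bilinAnnihilator_le hl hr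
  rw [Module.finrank_fin_fun] at hle heq
  rw [finrank_ker_tensorActionL, mem_glOrbit_iff_isotopic]
  refine ⟨hiso.finrank_bilinAnnihilator_eq ▸ hle, fun h => ?_, fun h => ?_⟩
  · obtain ⟨l, hν⟩ := heq (hiso.finrank_bilinAnnihilator_eq ▸ h)
    exact hiso.trans (hν.isotopic hU rfl)
  · rw [h.finrank_bilinAnnihilator_eq, hU.finrank_bilinAnnihilator, Module.finrank_fin_fun]
end

section
/- Let k ≥ 12 and let B ∈ ℂ^k ⊗ ℂ^k be a nondegenerate bilinear form whose skew-symmetric part Λ has corank e ≥ 2 and whose symmetric part Q has corank f > 0, with ℓ := k − e − f > 0. Then dim h_B ≤ binom(q,2) + binom(ℓ,2) − eq + e² + binom(f−κ+1,2) + fκ + binom(κ+1,2), where q = rank(Q|_{ker Λ}) and κ = f − rank(Λ|_{ker Q}); and this bound is at most binom(k,2) − k − 1. -/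
open Matrix

/-- The linear map `X ↦ XB + BXᵗ`; its kernel is the symmetry Lie algebra `h_B`
of the bilinear form `B`, i.e. the Lie algebra of the stabilizer of `B` under
`g · B = g B gᵗ`. -/
noncomputable def formActionL (n : Type*) [Fintype n] [DecidableEq n]
    (B : Matrix n n ℂ) : Matrix n n ℂ →ₗ[ℂ] Matrix n n ℂ where
  toFun X := X * B + B * Xᵀ
  map_add' X Y := by
    simp only [Matrix.transpose_add, Matrix.add_mul, Matrix.mul_add]
    abel
  map_smul' t X := by
    simp only [Matrix.transpose_smul, Matrix.smul_mul, Matrix.mul_smul,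
      RingHom.id_apply, smul_add]

section BilinearForms

open Module
open LinearMap (ker range mem_ker)

variable {K V W : Type*} [Field K] [AddCommGroup V] [Module K V] [AddCommGroup W] [Module K W]

lemma eq_zero_of_apply_basis_eq_zero {ε : K} {U C : Submodule K V} (hUC : IsCompl U C)
    {ι : Type*} (c : Basis ι K C) {ω : LinearMap.BilinForm K V}
    (hω : ∀ x y, ω x y = ε * ω y x) (hU : ∀ u ∈ U, ω u = 0)
    (h : ∀ i j, ω (c i) (c j) = 0) : ω = 0 := by
  have hC : ω.domRestrict₁₂ C C = 0 := c.ext fun i ↦ c.ext fun j ↦ h i j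
  have hU' (x u : V) (hu : u ∈ U) : ω x u = 0 := by
    rw [hω, hU u hu, LinearMap.zero_apply, mul_zero]
  ext x y
  obtain ⟨u, hu, v, hv, rfl⟩ := Submodule.mem_sup.1
    (hUC.sup_eq_top ▸ Submodule.mem_top : x ∈ U ⊔ C)
  obtain ⟨u', hu', v', hv', rfl⟩ := Submodule.mem_sup.1
    (hUC.sup_eq_top ▸ Submodule.mem_top : y ∈ U ⊔ C)
  have hvv : ω v v' = 0 := congr($hC ⟨v, hv⟩ ⟨v', hv'⟩)
  rw [map_add ω, hU u hu, zero_add, map_add, hU' v u' hu', hvv, add_zero]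
  rfl

lemma finrank_le_add_finrank_inf_ker [FiniteDimensional K V] [FiniteDimensional K W]
    (H : Submodule K V) (φ : V →ₗ[K] W) (T : Submodule K W) (h : ∀ x ∈ H, φ x ∈ T) :
    finrank K H ≤ finrank K T + finrank K ↥(H ⊓ ker φ) := by
  have h1 := LinearMap.finrank_range_add_finrank_ker (φ.domRestrict H)
  have h2 : finrank K (range (φ.domRestrict H)) ≤ finrank K T := by
    refine Submodule.finrank_mono ?_
    rintro _ ⟨x, rfl⟩
    exact h x x.2
  have h3 : (ker (φ.domRestrict H)).map H.subtype = H ⊓ ker φ := by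
    ext x
    simp [and_comm]
  rw [← h3, Submodule.finrank_map_subtype_eq]
  omega

/-- A space `H` parametrizing bilinear forms `ω Z` which are symmetric or skew up to the sign `ε`
and have `U` in their radical: the values at the pairs of basis vectors of a complement of `U`
determine `ω Z`. -/
lemma finrank_le_card_add [FiniteDimensional K W] {ε : K} {U C : Submodule K V}
    (hUC : IsCompl U C) {ι : Type*} (c : Basis ι K C) (S : Set (Sym2 ι)) [Fintype S]
    (ω : W →ₗ[K] LinearMap.BilinForm K V) {H H' : Submodule K W}
    (hω : ∀ Z ∈ H, ∀ x y, ω Z x y = ε * ω Z y x) (hU : ∀ Z ∈ H, ∀ u ∈ U, ω Z u = 0)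
    (hS : ∀ Z ∈ H, ∀ i j, s(i, j) ∉ S → ω Z (c i) (c j) = 0)
    (hH' : ∀ Z ∈ H, ω Z = 0 → Z ∈ H') :
    finrank K H ≤ Fintype.card S + finrank K H' := by
  let φ : W →ₗ[K] S → K :=
    { toFun := fun Z a ↦ ω Z (c (Quot.out a.1).1) (c (Quot.out a.1).2)
      map_add' := fun _ _ ↦ by ext; simp
      map_smul' := fun _ _ ↦ by ext; simp }
  have h := finrank_le_add_finrank_inf_ker H φ ⊤ fun _ _ ↦ Submodule.mem_top
  rw [finrank_top, Module.finrank_fintype_fun_eq_card] at h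
  refine h.trans (Nat.add_le_add_left (Submodule.finrank_mono fun Z hZ ↦ ?_) _)
  refine hH' Z hZ.1 (eq_zero_of_apply_basis_eq_zero hUC c (hω Z hZ.1) (hU Z hZ.1) fun i j ↦ ?_)
  by_cases hij : s(i, j) ∈ S
  · have h1 : ω Z (c (Quot.out s(i, j)).1) (c (Quot.out s(i, j)).2) = 0 :=
      congrFun hZ.2 ⟨s(i, j), hij⟩
    have h2 : s((Quot.out s(i, j)).1, (Quot.out s(i, j)).2) = s(i, j) := Quot.out_eq _
    rcases Sym2.eq_iff.1 h2 with ⟨hi, hj⟩ | ⟨hi, hj⟩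
    · rwa [hi, hj] at h1
    · rw [hi, hj] at h1
      rw [hω Z hZ.1, h1, mul_zero]
  · exact hS Z hZ.1 i j hij

lemma finrank_le_choose_add_of_symm [FiniteDimensional K V] [FiniteDimensional K W]
    (U : Submodule K V) (ω : W →ₗ[K] LinearMap.BilinForm K V) {H H' : Submodule K W}
    (hω : ∀ Z ∈ H, ∀ x y, ω Z x y = ω Z y x) (hU : ∀ Z ∈ H, ∀ u ∈ U, ω Z u = 0)
    (hH' : ∀ Z ∈ H, ω Z = 0 → Z ∈ H') :
    finrank K H ≤ (finrank K V - finrank K U + 1).choose 2 + finrank K H' := by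
  classical
  obtain ⟨C, hC⟩ := U.exists_isCompl
  have h := finrank_le_card_add (ε := 1) hC (finBasis K C) Set.univ ω (by simpa using hω) hU
    (by simp) hH'
  have hd := Submodule.finrank_add_eq_of_isCompl hC
  rwa [Fintype.card_setUniv, Sym2.card, Fintype.card_fin,
    show finrank K C = finrank K V - finrank K U by omega] at h

lemma finrank_le_choose_add_of_skew [NeZero (2 : K)] [FiniteDimensional K V]
    [FiniteDimensional K W] (U : Submodule K V) (ω : W →ₗ[K] LinearMap.BilinForm K V)
    {H H' : Submodule K W} (hω : ∀ Z ∈ H, ∀ x y, ω Z x y = -ω Z y x)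
    (hU : ∀ Z ∈ H, ∀ u ∈ U, ω Z u = 0) (hH' : ∀ Z ∈ H, ω Z = 0 → Z ∈ H') :
    finrank K H ≤ (finrank K V - finrank K U).choose 2 + finrank K H' := by
  classical
  obtain ⟨C, hC⟩ := U.exists_isCompl
  have h := finrank_le_card_add (ε := -1) hC (finBasis K C) Sym2.diagSetᶜ ω
    (by simpa using hω) hU (fun Z hZ i j hij ↦ by
      obtain rfl : i = j := by simpa using hij
      have h2 : (2 : K) * ω Z (finBasis K C i) (finBasis K C i) = 0 := by
        linear_combination hω Z hZ (finBasis K C i) (finBasis K C i)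
      exact (mul_eq_zero.1 h2).resolve_left two_ne_zero) hH'
  have hd := Submodule.finrank_add_eq_of_isCompl hC
  rwa [Sym2.card_diagSet_compl, Fintype.card_fin,
    show finrank K C = finrank K V - finrank K U by omega] at h

lemma finrank_le_mul_of_apply_mem [FiniteDimensional K V] [FiniteDimensional K W]
    (T : Submodule K (V →ₗ[K] W)) (R : Submodule K W) (h : ∀ Z ∈ T, ∀ x, Z x ∈ R) :
    finrank K T ≤ finrank K V * finrank K R := by
  rw [← Module.finrank_linearMap K K]
  let φ : T →ₗ[K] V →ₗ[K] R :=
    { toFun := fun Z ↦ Z.1.codRestrict R (h Z Z.2)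
      map_add' := fun _ _ ↦ rfl
      map_smul' := fun _ _ ↦ rfl }
  refine LinearMap.finrank_le_finrank_of_injective (f := φ) fun Z Z' hZ ↦ ?_
  ext x
  exact congr(($hZ x : W))

/-- The linear maps `Z : E → V` with values in `E` which are skew-adjoint for the restriction
of `b` to `E`. -/
def skewAdjointMapsOn (b : LinearMap.BilinForm K V) (E : Submodule K V) :
    Submodule K (E →ₗ[K] V) where
  carrier := {Z | (∀ x, Z x ∈ E) ∧ ∀ x y : E, b (Z x) y = -b x (Z y)}
  zero_mem' := by simp
  add_mem' {Z Z'} hZ hZ' := by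
    refine ⟨fun x ↦ E.add_mem (hZ.1 x) (hZ'.1 x), fun x y ↦ ?_⟩
    simp only [LinearMap.add_apply, map_add, hZ.2 x y, hZ'.2 x y, neg_add]
  smul_mem' t Z hZ := by
    refine ⟨fun x ↦ E.smul_mem t (hZ.1 x), fun x y ↦ ?_⟩
    simp only [LinearMap.smul_apply, map_smul, hZ.2 x y, smul_neg]

/-- The linear map sending `Z` to the bilinear form `(x, y) ↦ b (Z x) y`. -/
def twistedForm (b : LinearMap.BilinForm K V) (E : Submodule K V) :
    (E →ₗ[K] V) →ₗ[K] LinearMap.BilinForm K E where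
  toFun Z := b.compl₁₂ Z E.subtype
  map_add' Z Z' := by ext; simp
  map_smul' t Z := by ext; simp

@[simp]
lemma twistedForm_apply (b : LinearMap.BilinForm K V) (E : Submodule K V) (Z : E →ₗ[K] V)
    (x y : E) :
    twistedForm b E Z x y = b (Z x) y :=
  rfl

lemma twistedForm_eq_zero_of_mem_ker {b : LinearMap.BilinForm K V} {E : Submodule K V}
    {Z : E →ₗ[K] V} (hZ : Z ∈ skewAdjointMapsOn b E) {u : E} (hu : u ∈ ker (b.restrict E)) :
    twistedForm b E Z u = 0 := by
  ext y
  have h : b u (Z y) = 0 := congr($hu ⟨Z y, hZ.1 y⟩)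
  rw [twistedForm_apply, hZ.2, h, neg_zero, LinearMap.zero_apply]

/-- The members of `skewAdjointMapsOn b E` with values in the radical of `b.restrict E`. -/
lemma finrank_skewAdjointMapsOn_inf_ker_le [FiniteDimensional K V] (b : LinearMap.BilinForm K V)
    (E : Submodule K V) :
    finrank K ↥(skewAdjointMapsOn b E ⊓ ker (twistedForm b E)) ≤
      finrank K E * finrank K (ker (b.restrict E)) := by
  rw [← Submodule.finrank_map_subtype_eq E (ker (b.restrict E))]
  refine finrank_le_mul_of_apply_mem _ _ fun Z hZ x ↦ ?_
  refine ⟨⟨Z x, hZ.1.1 x⟩, ?_, rfl⟩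
  ext y
  exact congr($(hZ.2) x y)

lemma finrank_skewAdjointMapsOn_le_of_symm [NeZero (2 : K)] [FiniteDimensional K V]
    (b : LinearMap.BilinForm K V) (hb : ∀ x y, b x y = b y x) (E : Submodule K V) :
    finrank K (skewAdjointMapsOn b E) ≤
      (finrank K E - finrank K (ker (b.restrict E))).choose 2 +
        finrank K E * finrank K (ker (b.restrict E)) :=
  (finrank_le_choose_add_of_skew (H' := skewAdjointMapsOn b E ⊓ ker (twistedForm b E))
    (ker (b.restrict E)) (twistedForm b E)
    (fun Z hZ x y ↦ by rw [twistedForm_apply, twistedForm_apply, hZ.2, hb])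
    (fun _ hZ _ ↦ twistedForm_eq_zero_of_mem_ker hZ) fun _ hZ h ↦ ⟨hZ, h⟩).trans
    (Nat.add_le_add_left (finrank_skewAdjointMapsOn_inf_ker_le b E) _)

lemma finrank_skewAdjointMapsOn_le_of_skew [FiniteDimensional K V]
    (b : LinearMap.BilinForm K V) (hb : ∀ x y, b x y = -b y x) (E : Submodule K V) :
    finrank K (skewAdjointMapsOn b E) ≤
      (finrank K E - finrank K (ker (b.restrict E)) + 1).choose 2 +
        finrank K E * finrank K (ker (b.restrict E)) :=
  (finrank_le_choose_add_of_symm (H' := skewAdjointMapsOn b E ⊓ ker (twistedForm b E))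
    (ker (b.restrict E)) (twistedForm b E)
    (fun Z hZ x y ↦ by rw [twistedForm_apply, twistedForm_apply, hZ.2, ← hb])
    (fun _ hZ _ ↦ twistedForm_eq_zero_of_mem_ker hZ) fun _ hZ h ↦ ⟨hZ, h⟩).trans
    (Nat.add_le_add_left (finrank_skewAdjointMapsOn_inf_ker_le b E) _)

/-- The endomorphisms skew-adjoint for `b` preserve the radical of `b`. -/
lemma apply_mem_ker_of_isSkewAdjoint {b : LinearMap.BilinForm K V} {Y : End K V}
    (hY : b.IsSkewAdjoint Y)
    {x : V} (hx : x ∈ ker b) : Y x ∈ ker b := by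
  ext y
  rw [hY x y, mem_ker.1 hx]
  rfl

variable {Q Λ : LinearMap.BilinForm K V}

lemma disjoint_ker_of_ker_add_eq_bot (hB : ker (Q + Λ) = ⊥) : Disjoint (ker Λ) (ker Q) := by
  rw [Submodule.disjoint_def]
  intro x hx hx'
  rw [← Submodule.mem_bot K, ← hB, mem_ker, LinearMap.add_apply, mem_ker.1 hx, mem_ker.1 hx',
    add_zero]

lemma finrank_ker_sup_ker [FiniteDimensional K V] (hB : ker (Q + Λ) = ⊥) :
    finrank K ↥(ker Λ ⊔ ker Q) = finrank K (ker Λ) + finrank K (ker Q) := by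
  have h := Submodule.finrank_sup_add_finrank_inf_eq (ker Λ) (ker Q)
  rwa [(disjoint_ker_of_ker_add_eq_bot hB).eq_bot, finrank_bot, add_zero] at h

/-- The radicals of `Q.restrict (ker Λ)` and `Λ.restrict (ker Q)` are independent, and `Q + Λ`
embeds their sum into the annihilator of `ker Λ ⊔ ker Q`. -/
lemma finrank_add_finrank_radicals_le [FiniteDimensional K V] (hQ : ∀ x y, Q x y = Q y x)
    (hΛ : ∀ x y, Λ x y = -Λ y x) (hB : ker (Q + Λ) = ⊥) :
    finrank K (ker (Q.restrict (ker Λ))) + finrank K (ker (Λ.restrict (ker Q))) +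
      (finrank K (ker Λ) + finrank K (ker Q)) ≤ finrank K V := by
  have hdisj := disjoint_ker_of_ker_add_eq_bot hB
  have hsup := finrank_ker_sup_ker hB
  set R := (ker (Q.restrict (ker Λ))).map (ker Λ).subtype
  set S := (ker (Λ.restrict (ker Q))).map (ker Q).subtype
  have hRS := Submodule.finrank_sup_add_finrank_inf_eq R S
  rw [(hdisj.mono (Submodule.map_subtype_le _ _) (Submodule.map_subtype_le _ _)).eq_bot,
    finrank_bot, add_zero, Submodule.finrank_map_subtype_eq,
    Submodule.finrank_map_subtype_eq] at hRS
  have hann : (R ⊔ S).map (Q + Λ) ≤ (ker Λ ⊔ ker Q).dualAnnihilator := by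
    rw [Submodule.map_le_iff_le_comap, sup_le_iff]
    constructor
    · rintro _ ⟨a, ha, rfl⟩
      refine (Submodule.mem_dualAnnihilator _).2 fun w hw ↦ ?_
      obtain ⟨u, hu, v, hv, rfl⟩ := Submodule.mem_sup.1 hw
      have h1 : Q a u = 0 := congr($ha ⟨u, hu⟩)
      have h2 : Λ a = 0 := a.2
      have h3 : Q a v = 0 := by rw [hQ, mem_ker.1 hv, LinearMap.zero_apply]
      simp [h1, h2, h3]
    · rintro _ ⟨a, ha, rfl⟩
      refine (Submodule.mem_dualAnnihilator _).2 fun w hw ↦ ?_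
      obtain ⟨u, hu, v, hv, rfl⟩ := Submodule.mem_sup.1 hw
      have h1 : Λ a v = 0 := congr($ha ⟨v, hv⟩)
      have h2 : Q a = 0 := a.2
      have h3 : Λ a u = 0 := by rw [hΛ, mem_ker.1 hu, LinearMap.zero_apply, neg_zero]
      simp [h1, h2, h3]
  have hle := Submodule.finrank_mono hann
  rw [← (Submodule.equivMapOfInjective _ (LinearMap.ker_eq_bot.1 hB) _).finrank_eq, hRS] at hle
  have hdual := (Nat.add_le_add_left hle _).trans_eq
    (Subspace.finrank_add_finrank_dualAnnihilator_eq (ker Λ ⊔ ker Q))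
  omega

/-- A bound for spaces of endomorphisms which are skew-adjoint for `Q` and `Λ` and vanish on both
radicals. -/
lemma finrank_skewAdjoint_inf_vanishing_le [NeZero (2 : K)] [FiniteDimensional K V]
    (hQ : ∀ x y, Q x y = Q y x) (hΛ : ∀ x y, Λ x y = -Λ y x) (hB : ker (Q + Λ) = ⊥)
    (H : Submodule K (End K V)) (hHQ : ∀ Y ∈ H, Q.IsSkewAdjoint Y)
    (hHΛ : ∀ Y ∈ H, Λ.IsSkewAdjoint Y) (hE : ∀ Y ∈ H, ∀ x ∈ ker Λ, Y x = 0)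
    (hF : ∀ Y ∈ H, ∀ x ∈ ker Q, Y x = 0) :
    finrank K H ≤ (finrank K V - finrank K (ker Λ) - finrank K (ker Q)).choose 2 +
      (finrank K (ker (Λ.restrict (ker Q))) + 1).choose 2 := by
  rw [Nat.sub_sub, ← finrank_ker_sup_ker hB]
  let φ (b : LinearMap.BilinForm K V) : End K V →ₗ[K] LinearMap.BilinForm K V :=
    { toFun := fun Y ↦ b ∘ₗ Y
      map_add' := fun Y Y' ↦ by ext; simp
      map_smul' := fun t Y ↦ by ext; simp }
  have hEF : ∀ Y ∈ H, ∀ x ∈ ker Λ ⊔ ker Q, Y x = 0 := by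
    intro Y hY x hx
    obtain ⟨u, hu, v, hv, rfl⟩ := Submodule.mem_sup.1 hx
    rw [map_add, hE Y hY u hu, hF Y hY v hv, add_zero]
  refine (finrank_le_choose_add_of_skew (H' := H ⊓ ker (φ Q)) (ker Λ ⊔ ker Q) (φ Q) ?_ ?_
    fun Y hY h ↦ ⟨hY, h⟩).trans (Nat.add_le_add_left ?_ _)
  · intro Y hY x y
    change Q (Y x) y = -Q (Y y) x
    rw [hHQ Y hY x y, hQ (Y y) x]
    simp
  · intro Y hY u hu
    change Q (Y u) = 0
    rw [hEF Y hY u hu, map_zero]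
  set S := (ker (Λ.restrict (ker Q))).map (ker Q).subtype
  set P : Submodule K V := ker (LinearMap.lcomp K K S.subtype ∘ₗ Λ.flip) with hP
  have hmemP {y : V} (hy : y ∈ P) {x : V} (hx : x ∈ S) : Λ x y = 0 := congr($hy ⟨x, hx⟩)
  have hmemS : ∀ Y ∈ H ⊓ ker (φ Q), ∀ x, Y x ∈ S := by
    intro Y hY x
    refine ⟨⟨Y x, congr($(hY.2) x)⟩, ?_, rfl⟩
    ext y
    change Λ (Y x) y = 0
    rw [hHΛ Y hY.1 x y, Pi.neg_apply, hF Y hY.1 y y.2, neg_zero, map_zero]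
  have hcodim : finrank K V - finrank K P ≤ finrank K (ker (Λ.restrict (ker Q))) := by
    have h1 := LinearMap.finrank_range_add_finrank_ker (LinearMap.lcomp K K S.subtype ∘ₗ Λ.flip)
    have h2 := Submodule.finrank_le (range (LinearMap.lcomp K K S.subtype ∘ₗ Λ.flip))
    rw [show finrank K (S →ₗ[K] K) = finrank K S from Subspace.dual_finrank_eq,
      show finrank K S = _ from Submodule.finrank_map_subtype_eq _ _] at h2
    rw [hP]
    omega
  have hsymm : ∀ Y ∈ H ⊓ ker (φ Q), ∀ x y, Λ (Y x) y = Λ (Y y) x := fun Y hY x y ↦ by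
    rw [hHΛ Y hY.1 x y, hΛ, Pi.neg_apply, map_neg, LinearMap.neg_apply, neg_neg]
  have hle := finrank_le_choose_add_of_symm (H := H ⊓ ker (φ Q)) (H' := ⊥) P (φ Λ) hsymm
    (fun Y hY u hu ↦ LinearMap.ext fun y ↦ (hsymm Y hY u y).trans (hmemP hu (hmemS Y hY y)))
    fun Y hY h ↦ (Submodule.mem_bot K).2 <| LinearMap.ext fun x ↦ by
      have h1 : Q (Y x) = 0 := congr($(hY.2) x)
      have h2 : Λ (Y x) = 0 := congr($h x)
      rw [LinearMap.zero_apply, ← Submodule.mem_bot K, ← hB, mem_ker, LinearMap.add_apply, h1, h2,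
        add_zero]
  rw [finrank_bot, add_zero] at hle
  exact hle.trans (Nat.choose_le_choose 2 (Nat.add_le_add_right hcodim 1))

/-- The dimension of the Lie algebra of endomorphisms skew-adjoint for both the symmetric part `Q`
and the skew part `Λ` of a nondegenerate bilinear form. -/
lemma finrank_inf_skewAdjointSubmodule_le [NeZero (2 : K)] [FiniteDimensional K V]
    (hQ : ∀ x y, Q x y = Q y x) (hΛ : ∀ x y, Λ x y = -Λ y x) (hB : ker (Q + Λ) = ⊥) :
    finrank K ↥(Q.skewAdjointSubmodule ⊓ Λ.skewAdjointSubmodule) ≤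
      (finrank K (ker Λ) - finrank K (ker (Q.restrict (ker Λ)))).choose 2 +
        finrank K (ker Λ) * finrank K (ker (Q.restrict (ker Λ))) +
      ((finrank K (ker Q) - finrank K (ker (Λ.restrict (ker Q))) + 1).choose 2 +
        finrank K (ker Q) * finrank K (ker (Λ.restrict (ker Q)))) +
      ((finrank K V - finrank K (ker Λ) - finrank K (ker Q)).choose 2 +
        (finrank K (ker (Λ.restrict (ker Q))) + 1).choose 2) := by
  let ρ (E : Submodule K V) : End K V →ₗ[K] E →ₗ[K] V := LinearMap.lcomp K V E.subtype
  set H := Q.skewAdjointSubmodule ⊓ Λ.skewAdjointSubmodule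
  have hHQ : ∀ Y ∈ H, Q.IsSkewAdjoint Y := fun Y hY ↦ (LinearMap.mem_skewAdjointSubmodule Y).1 hY.1
  have hHΛ : ∀ Y ∈ H, Λ.IsSkewAdjoint Y := fun Y hY ↦ (LinearMap.mem_skewAdjointSubmodule Y).1 hY.2
  have hE := finrank_le_add_finrank_inf_ker H (ρ (ker Λ)) (skewAdjointMapsOn Q (ker Λ))
    fun Y hY ↦ ⟨fun x ↦ apply_mem_ker_of_isSkewAdjoint (hHΛ Y hY) x.2,
      fun x y ↦ (hHQ Y hY x y).trans (map_neg _ _)⟩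
  have hF := finrank_le_add_finrank_inf_ker (H ⊓ ker (ρ (ker Λ))) (ρ (ker Q))
    (skewAdjointMapsOn Λ (ker Q))
    fun Y hY ↦ ⟨fun x ↦ apply_mem_ker_of_isSkewAdjoint (hHQ Y hY.1) x.2,
      fun x y ↦ (hHΛ Y hY.1 x y).trans (map_neg _ _)⟩
  have hE' := finrank_skewAdjointMapsOn_le_of_symm Q hQ (ker Λ)
  have hF' := finrank_skewAdjointMapsOn_le_of_skew Λ hΛ (ker Q)
  have hrest := finrank_skewAdjoint_inf_vanishing_le hQ hΛ hB
    (H ⊓ ker (ρ (ker Λ)) ⊓ ker (ρ (ker Q))) (fun Y hY ↦ hHQ Y hY.1.1) (fun Y hY ↦ hHΛ Y hY.1.1)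
    (fun Y hY x hx ↦ congr($(hY.1.2) ⟨x, hx⟩)) (fun Y hY x hx ↦ congr($(hY.2) ⟨x, hx⟩))
  omega

end BilinearForms

section Numerics

lemma two_mul_choose_two (n : ℕ) : (2 * n.choose 2 : ℤ) = n * (n - 1) := by
  induction n with
  | zero => simp
  | succ n ih =>
    rw [Nat.choose_succ_succ', Nat.choose_one_right]
    push_cast
    linear_combination ih

lemma radical_estimate {e f l r κ : ℤ} (he : 2 ≤ e) (hf : 1 ≤ f) (hl : 1 ≤ l) (hr : 0 ≤ r)
    (hκ : 0 ≤ κ) (hre : r ≤ e) (hκf : κ ≤ f) (hrκ : r + κ ≤ l) (hk : 12 ≤ e + f + l) :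
    r * (r + 1) + 2 * κ ^ 2 + 4 * f + 2 * e + 2 * l + 2 ≤ 2 * (e * f + e * l + f * l) := by
  obtain ⟨u, rfl⟩ : ∃ u, e = r + u := ⟨e - r, by ring⟩
  obtain ⟨t, rfl⟩ : ∃ t, f = κ + t := ⟨f - κ, by ring⟩
  obtain ⟨s, rfl⟩ : ∃ s, l = r + κ + s := ⟨l - (r + κ), by ring⟩
  have hu : 0 ≤ u := by linarith
  have ht : 0 ≤ t := by linarith
  have hs : 0 ≤ s := by linarith
  have h1 := mul_nonneg hr hκ
  have h2 := mul_nonneg hr ht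
  have h3 := mul_nonneg hr hs
  have h4 := mul_nonneg hr hu
  have h5 := mul_nonneg hκ ht
  have h6 := mul_nonneg hκ hs
  have h7 := mul_nonneg hκ hu
  have h8 := mul_nonneg ht hs
  have h9 := mul_nonneg ht hu
  have h10 := mul_nonneg hs hu
  rcases le_or_gt 3 r with h | h
  · nlinarith
  rcases le_or_gt 3 κ with h' | h'
  · interval_cases r <;> nlinarith
  interval_cases r <;> interval_cases κ <;> nlinarith

lemma bound_le_choose_sub {e f l r κ : ℕ} (he : 2 ≤ e) (hf : 1 ≤ f) (hl : 1 ≤ l) (hre : r ≤ e)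
    (hκf : κ ≤ f) (hrκ : r + κ ≤ l) (hk : 12 ≤ e + f + l) :
    ((e - r).choose 2 : ℤ) + l.choose 2 - e * (e - r : ℕ) + e ^ 2 +
        (f - κ + 1).choose 2 + f * κ + (κ + 1).choose 2 ≤
      ((e + f + l).choose 2 : ℤ) - (e + f + l : ℕ) - 1 := by
  have h := radical_estimate (e := e) (f := f) (l := l) (r := r) (κ := κ) (by omega) (by omega)
    (by omega) (by omega) (by omega) (by omega) (by omega) (by omega) (by omega)
  have h1 := two_mul_choose_two (e - r)
  have h2 := two_mul_choose_two l
  have h3 := two_mul_choose_two (f - κ + 1)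
  have h4 := two_mul_choose_two (κ + 1)
  have h5 := two_mul_choose_two (e + f + l)
  push_cast [hre, hκf] at h1 h2 h3 h4 h5 ⊢
  linarith

end Numerics

section Matrices

open Module
open LinearMap (ker range mem_ker)

lemma isSkewAdjoint_toLin'_transpose {n : Type*} [Fintype n] [DecidableEq n] {B X : Matrix n n ℂ}
    (h : X * B + B * Xᵀ = 0) : (toBilin' B).IsSkewAdjoint (toLin' Xᵀ) := by
  intro x y
  rw [Pi.neg_apply, map_neg, toBilin'_apply', toBilin'_apply', toLin'_apply, toLin'_apply,
    ← vecMul_transpose, transpose_transpose, ← dotProduct_mulVec, mulVec_mulVec, mulVec_mulVec,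
    eq_neg_of_add_eq_zero_left h, neg_mulVec, dotProduct_neg]

lemma finrank_ker_toBilin' {n : Type*} [Fintype n] [DecidableEq n] (A : Matrix n n ℂ) :
    finrank ℂ (ker (toBilin' A)) = Fintype.card n - A.rank := by
  have h : ker (toBilin' A) = ker (toLin' Aᵀ) := by
    ext x
    rw [mem_ker, mem_ker, toLin'_apply, mulVec_transpose, ← dotProduct_eq_zero_iff]
    simp only [LinearMap.ext_iff, toBilin'_apply', dotProduct_mulVec, LinearMap.zero_apply]
  have h2 := LinearMap.finrank_range_add_finrank_ker (toLin' Aᵀ)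
  have h3 : A.rank = finrank ℂ (range (toLin' Aᵀ)) := (rank_transpose A).symm
  rw [Module.finrank_fintype_fun_eq_card] at h2
  rw [h, h3]
  omega

lemma actions_eq_zero_of_mem_ker {n : Type*} [Fintype n] [DecidableEq n] {Q L X : Matrix n n ℂ}
    (hQ : Qᵀ = Q) (hL : Lᵀ = -L) (hX : X ∈ ker (formActionL n (Q + L))) :
    X * Q + Q * Xᵀ = 0 ∧ X * L + L * Xᵀ = 0 := by
  have h1 : X * (Q + L) + (Q + L) * Xᵀ = 0 := hX
  have h2 := congr($(h1)ᵀ)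
  simp only [transpose_add, transpose_mul, transpose_transpose, hQ, hL, transpose_zero] at h2
  have h3 : (2 : ℂ) • (X * Q + Q * Xᵀ) = 0 := by
    rw [← add_zero (0 : Matrix n n ℂ)]
    nth_rw 1 [← h1]
    rw [← h2, two_smul]
    noncomm_ring
  have h4 := (smul_eq_zero.1 h3).resolve_left two_ne_zero
  refine ⟨h4, ?_⟩
  rw [← h1, ← sub_eq_zero, ← neg_eq_zero, ← h4]
  noncomm_ring

lemma finrank_ker_formActionL_add_le {n : Type*} [Fintype n] [DecidableEq n]
    {Q L : Matrix n n ℂ} (hQ : Qᵀ = Q) (hL : Lᵀ = -L) :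
    finrank ℂ (ker (formActionL n (Q + L))) ≤
      finrank ℂ ↥((toBilin' Q).skewAdjointSubmodule ⊓ (toBilin' L).skewAdjointSubmodule) := by
  let ψ : Matrix n n ℂ ≃ₗ[ℂ] End ℂ (n → ℂ) := (transposeLinearEquiv n n ℂ ℂ).trans toLin'
  rw [← ψ.finrank_map_eq]
  refine Submodule.finrank_mono ?_
  rintro _ ⟨X, hX, rfl⟩
  obtain ⟨hXQ, hXL⟩ := actions_eq_zero_of_mem_ker hQ hL hX
  exact ⟨(LinearMap.mem_skewAdjointSubmodule _).2 (isSkewAdjoint_toLin'_transpose hXQ),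
    (LinearMap.mem_skewAdjointSubmodule _).2 (isSkewAdjoint_toLin'_transpose hXL)⟩

lemma toBilin'_apply_comm {n : Type*} [Fintype n] [DecidableEq n] (A : Matrix n n ℂ)
    (x y : n → ℂ) : toBilin' A x y = toBilin' Aᵀ y x := by
  rw [toBilin'_apply', toBilin'_apply', dotProduct_mulVec, mulVec_transpose, dotProduct_comm]

end Matrices

/-- The general bound of Lemma 5.1: for `k ≥ 12` and a nondegenerate bilinear
form `B = Q + Λ` on `ℂ^k` whose skew part has corank `e ≥ 2` and symmetric part
has corank `f > 0`, with `ℓ = k − e − f > 0`, `q = rank(Q|_{ker Λ})` and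
`κ = f − rank(Λ|_{ker Q})`, one has
`dim h_B ≤ C(q,2) + C(ℓ,2) − eq + e² + C(f−κ+1,2) + fκ + C(κ+1,2) ≤ C(k,2) − k − 1`. -/
theorem dim_hB_general_bound (k : ℕ) (hk : 12 ≤ k)
    (B Q L : Matrix (Fin k) (Fin k) ℂ) (hB : B = Q + L)
    (hQsymm : Qᵀ = Q) (hLskew : Lᵀ = -L) (hBnd : IsUnit B.det)
    (e f l q kappa : ℕ)
    (he : e = k - L.rank) (hf : f = k - Q.rank) (hl : l = k - e - f)
    (he2 : 2 ≤ e) (hf0 : 0 < f) (hl0 : 0 < l)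
    (hq : q = e - Module.finrank ℂ (LinearMap.ker
        ((Matrix.toBilin' Q).restrict (LinearMap.ker (Matrix.toBilin' L)))))
    (hkappa : kappa = Module.finrank ℂ (LinearMap.ker
        ((Matrix.toBilin' L).restrict (LinearMap.ker (Matrix.toBilin' Q))))) :
    (Module.finrank ℂ (LinearMap.ker (formActionL (Fin k) B)) : ℤ) ≤
      (Nat.choose q 2 : ℤ) + Nat.choose l 2 - e * q + e ^ 2 +
        Nat.choose (f - kappa + 1) 2 + f * kappa + Nat.choose (kappa + 1) 2 ∧
    (Nat.choose q 2 : ℤ) + Nat.choose l 2 - e * q + e ^ 2 +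
        Nat.choose (f - kappa + 1) 2 + f * kappa + Nat.choose (kappa + 1) 2 ≤
      (Nat.choose k 2 : ℤ) - k - 1 := by
  have hQ : ∀ x y, toBilin' Q x y = toBilin' Q y x := fun x y ↦ by
    rw [toBilin'_apply_comm, hQsymm]
  have hL : ∀ x y, toBilin' L x y = -toBilin' L y x := fun x y ↦ by
    rw [toBilin'_apply_comm, hLskew, map_neg, LinearMap.neg_apply, LinearMap.neg_apply]
  have hker : LinearMap.ker (toBilin' Q + toBilin' L) = ⊥ := by
    rw [← map_add, ← hB, ← Submodule.finrank_eq_zero (R := ℂ), finrank_ker_toBilin',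
      rank_of_isUnit _ ((isUnit_iff_isUnit_det B).2 hBnd), Nat.sub_self]
  have hE := finrank_ker_toBilin' L
  have hF := finrank_ker_toBilin' Q
  rw [Fintype.card_fin] at hE hF
  have hrad := finrank_add_finrank_radicals_le hQ hL hker
  have hdim := (finrank_ker_formActionL_add_le hQsymm hLskew).trans
    (finrank_inf_skewAdjointSubmodule_le hQ hL hker)
  have hre := Submodule.finrank_le
    (LinearMap.ker ((toBilin' Q).restrict (LinearMap.ker (toBilin' L))))
  have hκf := Submodule.finrank_le
    (LinearMap.ker ((toBilin' L).restrict (LinearMap.ker (toBilin' Q))))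
  rw [← hB] at hdim
  rw [hE, ← he] at hrad hdim hre
  rw [hF, ← hf] at hrad hdim hκf
  rw [Module.finrank_fin_fun] at hrad hdim
  rw [← hkappa] at hrad hdim hκf
  rw [← hl] at hdim
  generalize Module.finrank ℂ
    (LinearMap.ker ((toBilin' Q).restrict (LinearMap.ker (toBilin' L)))) = r at *
  subst hq
  constructor
  · zify [hre] at hdim ⊢
    linarith
  · obtain rfl : k = e + f + l := by omega
    exact bound_le_choose_sub he2 hf0 hl0 hre hκf (by omega) hk
end
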